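/- Let s ≥ 1, let v ∈ ℝ^s with ‖v‖ = 1, let t ∈ (0, 1), and set Γ := diag(1, −I_s) ∈ ℝ^{(s+1)×(s+1)} and M(ξ, w) := (1/2) [[1, wᵀ], [w, (1+ξ) I_s − ξ w wᵀ]]. Then the symmetric matrix −M(−t, −v) + 2t M(−1, −v) + (t + 1/t − 2) I_{s+1} + (1/2)(1 − 1/t) Γ is positive semidefinite. -/

import Mathlib

open Matrix

noncomputable section

/-- `ℝⁿ` with the Euclidean norm. -/
abbrev Vec (n : ℕ) : Type := EuclideanSpace ℝ (Fin n)

/-- The matrix `M(ξ, w) = (1/2) [[1, wᵀ], [w, (1+ξ)I − ξ w wᵀ]]`. -/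
def Mmat {s : ℕ} (ξ : ℝ) (w : Fin s → ℝ) : Matrix (Fin (s+1)) (Fin (s+1)) ℝ :=
  Matrix.of fun i j =>
    if hi : i = 0 then (if hj : j = 0 then 1/2 else w (j.pred hj) / 2)
    else if hj : j = 0 then w (i.pred hi) / 2
    else (1/2) * ((1+ξ) * (if i = j then 1 else 0) - ξ * w (i.pred hi) * w (j.pred hj))

/-- `Γ = diag(1, -I)`. -/
def GammaMat (s : ℕ) : Matrix (Fin (s+1)) (Fin (s+1)) ℝ :=
  Matrix.diagonal (fun j => if j = 0 then 1 else -1)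

/-- The quadratic form of `M(ξ, w)`, with the first coordinate separated. -/
theorem dotProduct_Mmat_mulVec {s : ℕ} (ξ : ℝ) (w : Fin s → ℝ) (u : Fin (s+1) → ℝ) :
    u ⬝ᵥ Mmat ξ w *ᵥ u = (1/2) * (u 0 ^ 2 + 2 * u 0 * (w ⬝ᵥ Fin.tail u)
      + (1+ξ) * (Fin.tail u ⬝ᵥ Fin.tail u) - ξ * (w ⬝ᵥ Fin.tail u) ^ 2) := by
  have h0 : (Mmat ξ w *ᵥ u) 0 = (1/2) * (u 0 + w ⬝ᵥ Fin.tail u) := by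
    simp only [Mmat, mulVec, dotProduct, Fin.sum_univ_succ, of_apply, Fin.succ_ne_zero,
      dite_true, dite_false, Fin.pred_succ, Fin.tail, mul_add, Finset.mul_sum]
    congr 1
    exact Finset.sum_congr rfl fun i _ => by ring
  have hsucc (i : Fin s) : (Mmat ξ w *ᵥ u) i.succ
      = (1/2) * (u 0 * w i + (1+ξ) * Fin.tail u i - ξ * (w ⬝ᵥ Fin.tail u) * w i) := by
    have hrow : ∑ j, (1/2) * ((1+ξ) * (if i = j then 1 else 0) - ξ * w i * w j) * u j.succ
        = (1/2) * ((1+ξ) * ∑ j, (if i = j then u j.succ else 0)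
          - ξ * w i * ∑ j, w j * u j.succ) := by
      simp only [Finset.mul_sum, ← Finset.sum_sub_distrib]
      exact Finset.sum_congr rfl fun j _ => by split_ifs <;> ring
    simp only [Mmat, mulVec, dotProduct, Fin.sum_univ_succ, of_apply, Fin.succ_ne_zero,
      dite_true, dite_false, Fin.pred_succ, Fin.tail, Fin.succ_inj]
    rw [hrow, Finset.sum_ite_eq, if_pos (Finset.mem_univ i)]
    ring
  have htail : ∑ i : Fin s, u i.succ * (Mmat ξ w *ᵥ u) i.succ
      = (1/2) * (u 0 * (w ⬝ᵥ Fin.tail u) + (1+ξ) * (Fin.tail u ⬝ᵥ Fin.tail u)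
        - ξ * (w ⬝ᵥ Fin.tail u) * (w ⬝ᵥ Fin.tail u)) := by
    simp only [hsucc]
    generalize hp : ξ * (w ⬝ᵥ Fin.tail u) = p
    simp only [dotProduct, Finset.mul_sum, ← Finset.sum_sub_distrib, ← Finset.sum_add_distrib]
    exact Finset.sum_congr rfl fun i _ => by simp only [Fin.tail]; ring
  rw [dotProduct, Fin.sum_univ_succ, h0, htail]
  ring

/-- The quadratic form of `Γ`, with the first coordinate separated. -/
theorem dotProduct_GammaMat_mulVec {s : ℕ} (u : Fin (s+1) → ℝ) :
    u ⬝ᵥ GammaMat s *ᵥ u = u 0 ^ 2 - Fin.tail u ⬝ᵥ Fin.tail u := by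
  simp only [GammaMat, dotProduct, mulVec_diagonal, Fin.sum_univ_succ, Fin.succ_ne_zero,
    if_true, if_false, Fin.tail, one_mul, neg_mul, mul_neg, Finset.sum_neg_distrib]
  ring

/-- For a unit vector `v ∈ ℝˢ` and `t ∈ (0,1)`, the symmetric
matrix `−M(−t, −v) + 2t M(−1, −v) + (t + 1/t − 2) I + ½(1 − 1/t) Γ` is positive
semidefinite. -/
theorem stmt_8 {s : ℕ} (hs : 1 ≤ s) (v : Vec s) (hv : ‖v‖ = 1)
    (t : ℝ) (ht : t ∈ Set.Ioo (0:ℝ) 1) :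
    ∀ u : Fin (s+1) → ℝ,
      0 ≤ u ⬝ᵥ (-(Mmat (-t) (fun j => -(v j)))
        + (2*t) • Mmat (-1) (fun j => -(v j))
        + (t + 1/t - 2) • (1 : Matrix (Fin (s+1)) (Fin (s+1)) ℝ)
        + ((1/2) * (1 - 1/t)) • GammaMat s) *ᵥ u := by
  intro u
  obtain ⟨ht0, -⟩ := ht
  have hsq : u ⬝ᵥ u = u 0 ^ 2 + Fin.tail u ⬝ᵥ Fin.tail u := by
    simp only [dotProduct, Fin.sum_univ_succ, Fin.tail, pow_two]
  have hq : 0 ≤ Fin.tail u ⬝ᵥ Fin.tail u :=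
    Finset.sum_nonneg fun i _ => mul_self_nonneg (Fin.tail u i)
  simp only [add_mulVec, neg_mulVec, smul_mulVec, dotProduct_add, dotProduct_neg,
    dotProduct_smul, one_mulVec, dotProduct_Mmat_mulVec, dotProduct_GammaMat_mulVec, hsq,
    smul_eq_mul]
  generalize (fun j => -(v j)) ⬝ᵥ Fin.tail u = p
  generalize Fin.tail u ⬝ᵥ Fin.tail u = q at hq ⊢
  generalize u 0 = a
  have hnonneg : 0 ≤ (((2*t - 1) * a + t * p) ^ 2 + 3 * (1 - t) ^ 2 * q) / (2*t) := by
    positivity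
  refine hnonneg.trans_eq ?_
  field_simp
  ring

end
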